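/- Let α > 0 and 1 < p < ∞ with p ≠ Q, Q = m + (α+1)k, and assume Q > p. With ω_{α,p} = ∫_{{ρ<1}} (Φ⁰(z)/ρ(z,σ))^{αp} dz dσ, σ_{α,p} = Q ω_{α,p}, and C_{α,p} = ((p−1)/(Q−p)) σ_{α,p}^{−1/(p−1)}, fix σ₀ ∈ ℝ^k and set 𝒢_{σ₀}(z,σ) = C_{α,p} ρ(z, σ−σ₀)^{−(Q−p)/(p−1)}. Then for every φ ∈ C_c^∞(ℝ^N): ∫_{ℝ^N} (Φ(∇_z 𝒢_{σ₀})² + (Φ⁰(z)^{2α}/4)Ψ(∇_σ 𝒢_{σ₀})²)^{(p−2)/2} ( Φ(∇_z 𝒢_{σ₀})⟨∇Φ(∇_z 𝒢_{σ₀}), ∇_z φ⟩ + (Φ⁰(z)^{2α}/4)Ψ(∇_σ 𝒢_{σ₀})⟨∇Ψ(∇_σ 𝒢_{σ₀}), ∇_σ φ⟩ ) dz dσ = φ(0,σ₀); i.e., 𝒢_{σ₀} is a fundamental solution of −𝓛_{α,p} with pole at (0,σ₀). -/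

import Mathlib

open Real MeasureTheory
open scoped RealInnerProductSpace

noncomputable section

abbrev Euc (n : ℕ) := EuclideanSpace ℝ (Fin n)

/-- A Minkowski norm on `ℝⁿ`: nonnegative, absolutely homogeneous, with `N²` of class `C²`
away from the origin and strictly convex. -/
def IsMinkowskiNorm {n : ℕ} (N : Euc n → ℝ) : Prop :=
  (∀ x, 0 ≤ N x) ∧ (∀ (l : ℝ) (x : Euc n), N (l • x) = |l| * N x) ∧
  ContDiffOn ℝ 2 (fun x => (N x) ^ 2) {(0 : Euc n)}ᶜ ∧
  StrictConvexOn ℝ Set.univ (fun x => (N x) ^ 2)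

/-- The Legendre transform (dual norm) `N⁰(x) = sup { ⟨x,ξ⟩ : N(ξ) = 1 }`. -/
def dualNorm {n : ℕ} (N : Euc n → ℝ) (x : Euc n) : ℝ :=
  sSup ((fun ξ => ⟪x, ξ⟫) '' {ξ | N ξ = 1})

variable {m k : ℕ}

/-- The dual anisotropic Minkowski gauge
`ρ(z,σ) = (Φ⁰(z)^{2(α+1)} + 4(α+1)²Ψ⁰(σ)²)^{1/(2(α+1))}`. -/
def rho (α : ℝ) (Φ : Euc m → ℝ) (Ψ : Euc k → ℝ) (x : Euc m × Euc k) : ℝ :=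
  (dualNorm Φ x.1 ^ (2 * (α + 1)) + 4 * (α + 1) ^ 2 * dualNorm Ψ x.2 ^ 2) ^ (1 / (2 * (α + 1)))

/-- Gradient in the `z` variables. -/
def gradZ (u : Euc m × Euc k → ℝ) (x : Euc m × Euc k) : Euc m :=
  gradient (fun z => u (z, x.2)) x.1

/-- Gradient in the `σ` variables. -/
def gradS (u : Euc m × Euc k → ℝ) (x : Euc m × Euc k) : Euc k :=
  gradient (fun σ => u (x.1, σ)) x.2

/-- Divergence in the `z` variables. -/
def divZ (V : Euc m × Euc k → Euc m) (x : Euc m × Euc k) : ℝ :=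
  ∑ i, fderiv ℝ (fun z => V (z, x.2) i) x.1 (EuclideanSpace.single i 1)

/-- Divergence in the `σ` variables. -/
def divS (V : Euc m × Euc k → Euc k) (x : Euc m × Euc k) : ℝ :=
  ∑ i, fderiv ℝ (fun σ => V (x.1, σ) i) x.2 (EuclideanSpace.single i 1)

/-- The Finsler Laplacian in the `z` variables, `Δ_Φ(u) = div_z(Φ(∇_z u) ∇Φ(∇_z u))`. -/
def finslerLapZ (Φ : Euc m → ℝ) (u : Euc m × Euc k → ℝ) (x : Euc m × Euc k) : ℝ :=
  divZ (fun y => Φ (gradZ u y) • gradient Φ (gradZ u y)) x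

/-- The Finsler Laplacian in the `σ` variables, `Δ_Ψ(u) = div_σ(Ψ(∇_σ u) ∇Ψ(∇_σ u))`. -/
def finslerLapS (Ψ : Euc k → ℝ) (u : Euc m × Euc k → ℝ) (x : Euc m × Euc k) : ℝ :=
  divS (fun y => Ψ (gradS u y) • gradient Ψ (gradS u y)) x

/-- The operator `𝓛_{α,p}`. -/
def Lop (α p : ℝ) (Φ : Euc m → ℝ) (Ψ : Euc k → ℝ) (u : Euc m × Euc k → ℝ)
    (x : Euc m × Euc k) : ℝ :=
  divZ (fun y =>
      (Φ (gradZ u y) ^ 2 + dualNorm Φ y.1 ^ (2 * α) / 4 * Ψ (gradS u y) ^ 2) ^ ((p - 2) / 2) •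
        (Φ (gradZ u y) • gradient Φ (gradZ u y))) x
  + divS (fun y =>
      (Φ (gradZ u y) ^ 2 + dualNorm Φ y.1 ^ (2 * α) / 4 * Ψ (gradS u y) ^ 2) ^ ((p - 2) / 2) •
        ((dualNorm Φ y.1 ^ (2 * α) / 4 * Ψ (gradS u y)) • gradient Ψ (gradS u y))) x

/-- The operator `𝓛_{α,2}(u) = Δ_Φ(u) + (Φ⁰(z)^{2α}/4) Δ_Ψ(u)`. -/
def Lop2 (α : ℝ) (Φ : Euc m → ℝ) (Ψ : Euc k → ℝ) (u : Euc m × Euc k → ℝ)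
    (x : Euc m × Euc k) : ℝ :=
  finslerLapZ Φ u x + dualNorm Φ x.1 ^ (2 * α) / 4 * finslerLapS Ψ u x

/-- A continuous positively homogeneous function that is positive away from the origin. -/
structure IsGauge {n : ℕ} (a : Euc n → ℝ) : Prop where
  continuous : Continuous a
  smul : ∀ l : ℝ, 0 ≤ l → ∀ x, a (l • x) = l * a x
  pos : ∀ x, x ≠ 0 → 0 < a x

namespace IsGauge

variable {n : ℕ} {a : Euc n → ℝ}

lemma map_zero (ha : IsGauge a) : a 0 = 0 := by
  simpa using ha.smul 0 le_rfl 0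

lemma nonneg (ha : IsGauge a) (x : Euc n) : 0 ≤ a x := by
  rcases eq_or_ne x 0 with rfl | hx
  · exact ha.map_zero.ge
  · exact (ha.pos x hx).le

lemma exists_mul_norm_le (ha : IsGauge a) (hn : 1 ≤ n) : ∃ c, 0 < c ∧ ∀ x, c * ‖x‖ ≤ a x := by
  have : Nonempty (Fin n) := ⟨⟨0, hn⟩⟩
  have : Nontrivial (Euc n) := inferInstance
  obtain ⟨e, he, hmin⟩ := (isCompact_sphere (0 : Euc n) 1).exists_isMinOn
    (NormedSpace.sphere_nonempty.2 zero_le_one) ha.continuous.continuousOn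
  have he0 : e ≠ 0 := by
    rintro rfl
    simp at he
  refine ⟨a e, ha.pos e he0, fun x => ?_⟩
  rcases eq_or_ne x 0 with rfl | hx
  · simp [ha.map_zero]
  have hx' : 0 < ‖x‖ := norm_pos_iff.2 hx
  have h1 : a e ≤ a (‖x‖⁻¹ • x) := hmin (by simp [norm_smul, hx'.ne'])
  rw [ha.smul _ (by positivity)] at h1
  calc a e * ‖x‖ ≤ (‖x‖⁻¹ * a x) * ‖x‖ := by gcongr
    _ = a x := by field_simp

end IsGauge

namespace IsMinkowskiNorm

variable {n : ℕ} {N : Euc n → ℝ}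

lemma pos (h : IsMinkowskiNorm N) {x : Euc n} (hx : x ≠ 0) : 0 < N x := by
  obtain ⟨h0, h1, -, h3⟩ := h
  refine (h0 x).lt_of_ne' fun hz => ?_
  have h00 : N 0 = 0 := by simpa using h1 0 0
  have := h3.2 (Set.mem_univ x) (Set.mem_univ 0) hx one_half_pos one_half_pos (add_halves 1)
  simp only [h1, hz, h00, smul_zero, add_zero] at this
  norm_num at this

lemma isGauge (h : IsMinkowskiNorm N) : IsGauge N where
  continuous := by
    have hc : Continuous fun x => N x ^ 2 :=
      continuousOn_univ.1 (h.2.2.2.convexOn.continuousOn isOpen_univ)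
    exact (Real.continuous_sqrt.comp hc).congr fun x => Real.sqrt_sq (h.1 x)
  smul l hl x := by rw [h.2.1, abs_of_nonneg hl]
  pos _ hx := h.pos hx

lemma isCompact_sphere (h : IsMinkowskiNorm N) (hn : 1 ≤ n) : IsCompact {ξ | N ξ = 1} := by
  obtain ⟨c, hc, hcN⟩ := h.isGauge.exists_mul_norm_le hn
  refine (isCompact_closedBall (0 : Euc n) c⁻¹).of_isClosed_subset
    (isClosed_eq h.isGauge.continuous continuous_const) fun ξ hξ => ?_
  rw [mem_closedBall_zero_iff, ← mul_one c⁻¹, ← show N ξ = 1 from hξ, le_inv_mul_iff₀ hc]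
  exact hcN ξ

lemma normalize (h : IsMinkowskiNorm N) {x : Euc n} (hx : x ≠ 0) : N ((N x)⁻¹ • x) = 1 := by
  rw [h.2.1, abs_of_pos (inv_pos.2 (h.pos hx)), inv_mul_cancel₀ (h.pos hx).ne']

lemma sphere_nonempty (h : IsMinkowskiNorm N) (hn : 1 ≤ n) : {ξ | N ξ = 1}.Nonempty := by
  have : Nonempty (Fin n) := ⟨⟨0, hn⟩⟩
  obtain ⟨x, hx⟩ := exists_ne (0 : Euc n)
  exact ⟨_, h.normalize hx⟩

lemma inner_le_dualNorm (h : IsMinkowskiNorm N) (hn : 1 ≤ n) (x : Euc n) {ξ : Euc n}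
    (hξ : N ξ = 1) : ⟪x, ξ⟫ ≤ dualNorm N x :=
  le_csSup ((h.isCompact_sphere hn).image (by fun_prop)).bddAbove ⟨ξ, hξ, rfl⟩

lemma exists_inner_eq_dualNorm (h : IsMinkowskiNorm N) (hn : 1 ≤ n) (x : Euc n) :
    ∃ ξ, N ξ = 1 ∧ ⟪x, ξ⟫ = dualNorm N x :=
  ((h.isCompact_sphere hn).image (by fun_prop : Continuous fun ξ => ⟪x, ξ⟫)).sSup_mem
    ((h.sphere_nonempty hn).image _)

lemma inner_le_dualNorm_mul (h : IsMinkowskiNorm N) (hn : 1 ≤ n) (x ξ : Euc n) :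
    ⟪x, ξ⟫ ≤ dualNorm N x * N ξ := by
  rcases eq_or_ne ξ 0 with rfl | hξ
  · simp [h.isGauge.map_zero]
  have := h.inner_le_dualNorm hn x (h.normalize hξ)
  rwa [inner_smul_right, inv_mul_le_iff₀ (h.pos hξ), mul_comm] at this

lemma dualNorm_pos (h : IsMinkowskiNorm N) (hn : 1 ≤ n) {x : Euc n} (hx : x ≠ 0) :
    0 < dualNorm N x := by
  have := h.inner_le_dualNorm_mul hn x x
  exact pos_of_mul_pos_left ((real_inner_self_pos.2 hx).trans_le this) (h.1 x)

lemma inner_lt_dualNorm (h : IsMinkowskiNorm N) (hn : 1 ≤ n) {x ξ η : Euc n} (hx : x ≠ 0)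
    (hξ : N ξ = 1) (hη : N η = 1) (hξx : ⟪x, ξ⟫ = dualNorm N x) (hne : η ≠ ξ) :
    ⟪x, η⟫ < dualNorm N x := by
  refine (h.inner_le_dualNorm hn x hη).lt_of_ne fun heq => ?_
  have h1 := h.2.2.2.2 (Set.mem_univ η) (Set.mem_univ ξ) hne one_half_pos one_half_pos
    (add_halves 1)
  simp only [hξ, hη] at h1
  have h2 := h.inner_le_dualNorm_mul hn x ((1 / 2 : ℝ) • η + (1 / 2 : ℝ) • ξ)
  rw [inner_add_right, inner_smul_right, inner_smul_right, heq, hξx] at h2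
  have h3 := h.dualNorm_pos hn hx
  have h4 : 1 ≤ N ((1 / 2 : ℝ) • η + (1 / 2 : ℝ) • ξ) := by
    by_contra! h5
    nlinarith
  simp only [smul_eq_mul] at h1
  nlinarith

lemma exists_abs_dualNorm_sub_le (h : IsMinkowskiNorm N) (hn : 1 ≤ n) :
    ∃ R, 0 < R ∧ (∀ ξ, N ξ = 1 → ‖ξ‖ ≤ R) ∧
      ∀ x y, dualNorm N x ≤ dualNorm N y + R * ‖x - y‖ := by
  obtain ⟨R, hR, hb⟩ := (h.isCompact_sphere hn).isBounded.exists_pos_norm_le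
  refine ⟨R, hR, hb, fun x y => ?_⟩
  obtain ⟨ξ, hξ, hx⟩ := h.exists_inner_eq_dualNorm hn x
  have h1 := h.inner_le_dualNorm hn y hξ
  have h2 := real_inner_le_norm (x - y) ξ
  rw [inner_sub_left] at h2
  have h3 : ‖x - y‖ * ‖ξ‖ ≤ ‖x - y‖ * R := by gcongr; exact hb ξ hξ
  linarith

lemma dualNorm_isGauge (h : IsMinkowskiNorm N) (hn : 1 ≤ n) : IsGauge (dualNorm N) where
  continuous := by
    obtain ⟨R, hR, -, hL⟩ := h.exists_abs_dualNorm_sub_le hn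
    exact (LipschitzWith.of_le_add_mul ⟨R, hR.le⟩ fun x y => by
      rw [dist_eq_norm]; exact hL x y).continuous
  smul l hl x := by
    have h1 : ∀ ξ, ⟪l • x, ξ⟫ = l * ⟪x, ξ⟫ := fun ξ => by
      rw [inner_smul_left]; rfl
    obtain ⟨ξ, hξ, hx⟩ := h.exists_inner_eq_dualNorm hn x
    obtain ⟨η, hη, hy⟩ := h.exists_inner_eq_dualNorm hn (l • x)
    apply le_antisymm
    · rw [← hy, h1]
      exact mul_le_mul_of_nonneg_left (h.inner_le_dualNorm hn x hη) hl
    · rw [← hx, ← h1]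
      exact h.inner_le_dualNorm hn _ hξ
  pos _ hx := h.dualNorm_pos hn hx

lemma hasGradientAt_dualNorm (h : IsMinkowskiNorm N) (hn : 1 ≤ n) {x ξ : Euc n} (hx : x ≠ 0)
    (hξ : N ξ = 1) (hξx : ⟪x, ξ⟫ = dualNorm N x) : HasGradientAt (dualNorm N) ξ x := by
  obtain ⟨R, hR, hb, hL⟩ := h.exists_abs_dualNorm_sub_le hn
  rw [hasGradientAt_iff_hasFDerivAt, hasFDerivAt_iff_isLittleO, Asymptotics.isLittleO_iff]
  intro ε hε
  have hK : IsCompact ({η | N η = 1} \ Metric.ball ξ ε) :=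
    (h.isCompact_sphere hn).diff Metric.isOpen_ball
  obtain ⟨M, hM, hMK⟩ : ∃ M < dualNorm N x, ∀ η ∈ {η | N η = 1} \ Metric.ball ξ ε,
      ⟪x, η⟫ ≤ M := by
    rcases ({η | N η = 1} \ Metric.ball ξ ε).eq_empty_or_nonempty with hE | hE
    · exact ⟨dualNorm N x - 1, by linarith, by simp [hE]⟩
    · obtain ⟨η, hη, hmax⟩ := hK.exists_isMaxOn hE
        (by fun_prop : Continuous fun η => ⟪x, η⟫).continuousOn
      refine ⟨_, h.inner_lt_dualNorm hn hx hξ hη.1 hξx ?_, fun _ h' => hmax h'⟩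
      rintro rfl
      exact hη.2 (Metric.mem_ball_self hε)
  have hδ : 0 < (dualNorm N x - M) / (2 * R) := div_pos (by linarith) (by linarith)
  filter_upwards [Metric.ball_mem_nhds x hδ] with y hy
  rw [mem_ball_iff_norm, lt_div_iff₀ (by linarith)] at hy
  obtain ⟨η, hη, hyη⟩ := h.exists_inner_eq_dualNorm hn y
  have hle := real_inner_le_norm (y - x) η
  have h1 : ‖y - x‖ * ‖η‖ ≤ ‖y - x‖ * R := by gcongr; exact hb η hη
  have hxy := hL x y
  rw [norm_sub_rev] at hxy
  have hclose : ‖η - ξ‖ < ε := by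
    by_contra hfar
    have := hMK η ⟨hη, by rwa [mem_ball_iff_norm]⟩
    rw [inner_sub_left] at hle
    linarith
  have hlow := h.inner_le_dualNorm hn y hξ
  have hup := h.inner_le_dualNorm hn x hη
  have hcs := real_inner_le_norm (y - x) (η - ξ)
  have h2 : ‖y - x‖ * ‖η - ξ‖ ≤ ε * ‖y - x‖ := by
    rw [mul_comm]; gcongr
  simp only [InnerProductSpace.toDual_apply_apply, Real.norm_eq_abs]
  rw [real_inner_comm]
  simp only [inner_sub_left, inner_sub_right] at hcs ⊢
  rw [abs_le]
  constructor <;> nlinarith [norm_nonneg (y - x)]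

lemma differentiableAt (h : IsMinkowskiNorm N) {x : Euc n} (hx : x ≠ 0) :
    DifferentiableAt ℝ N x := by
  have h1 : DifferentiableAt ℝ (fun y => N y ^ 2) x :=
    ((h.2.2.1.contDiffAt (isOpen_compl_singleton.mem_nhds hx)).differentiableAt (by norm_num))
  have h2 := h1.sqrt (pow_pos (h.pos hx) 2).ne'
  refine h2.congr_of_eventuallyEq (.of_forall fun y => (Real.sqrt_sq (h.1 y)).symm)

lemma gradient_eq_of_inner_eq (h : IsMinkowskiNorm N) (hn : 1 ≤ n) {x ξ : Euc n} (hx : x ≠ 0)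
    (hξ : N ξ = 1) (hξx : ⟪x, ξ⟫ = dualNorm N x) :
    gradient N ξ = (dualNorm N x)⁻¹ • x := by
  have hξ0 : ξ ≠ 0 := by
    rintro rfl
    rw [h.isGauge.map_zero] at hξ
    exact zero_ne_one hξ
  have hd := (h.differentiableAt hξ0).hasFDerivAt
  have hmax : IsLocalMax (fun η => innerSL ℝ x η - dualNorm N x * N η) ξ := by
    refine .of_forall fun η => ?_
    simp only [innerSL_apply_apply, hξx, hξ]
    linarith [h.inner_le_dualNorm_mul hn x η]
  have h0 := hmax.hasFDerivAt_eq_zero ((innerSL ℝ x).hasFDerivAt.sub (hd.const_mul _))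
  have hpos := h.dualNorm_pos hn hx
  refine ext_inner_right ℝ fun v => ?_
  have h1 := DFunLike.congr_fun h0 v
  simp only [sub_apply, innerSL_apply_apply, smul_apply, smul_eq_mul, zero_apply] at h1
  rw [inner_gradient_left, real_inner_smul_left, eq_inv_mul_iff_mul_eq₀ hpos.ne']
  linarith

lemma smul_gradient_smul (h : IsMinkowskiNorm N) {ξ : Euc n} (hξ : ξ ≠ 0) (c : ℝ) :
    N (c • ξ) • gradient N (c • ξ) = c • N ξ • gradient N ξ := by
  rcases eq_or_ne c 0 with rfl | hc
  · simp [h.isGauge.map_zero]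
  have h1 : HasFDerivAt (fun η => N (c • η)) (|c| • fderiv ℝ N ξ) ξ := by
    simp only [h.2.1]
    exact (h.differentiableAt hξ).hasFDerivAt.const_mul _
  have h2 := ((h.differentiableAt (smul_ne_zero hc hξ)).hasFDerivAt).comp ξ
    ((c • ContinuousLinearMap.id ℝ (Euc n)).hasFDerivAt)
  have h3 := h1.unique h2
  refine ext_inner_right ℝ fun v => ?_
  have h4 := DFunLike.congr_fun h3 v
  simp only [ContinuousLinearMap.comp_apply, smul_apply,
    ContinuousLinearMap.id_apply, map_smul, smul_eq_mul] at h4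
  rw [← inner_gradient_left, ← inner_gradient_left] at h4
  simp only [inner_smul_left, h.2.1, RCLike.conj_to_real]
  have h5 : |c| * |c| = c * c := abs_mul_abs_self c
  have : c * (|c| * ⟪gradient N (c • ξ), v⟫ - c * ⟪gradient N ξ, v⟫) = 0 := by
    linear_combination (-|c|) * h4 + ⟪gradient N ξ, v⟫ * h5
  have := (mul_eq_zero.1 this).resolve_left hc
  linear_combination N ξ * this

end IsMinkowskiNorm

/-- If a flow `T` preserves `μ` and almost every point has sojourn time `1` in the set `A`, then `μ`
is the image of `μ.restrict A` times Lebesgue measure under the flow map. -/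
theorem map_flow_restrict_prod {X : Type*} [MeasurableSpace X] (μ : Measure X) [SFinite μ]
    (T : ℝ → X → X) (hT : Measurable fun q : X × ℝ => T q.2 q.1) (hinv : ∀ s, μ.map (T s) = μ)
    (hneg : ∀ s x, T (-s) (T s x) = x) {A : Set X} (hA : MeasurableSet A)
    (hvol : ∀ᵐ x ∂μ, volume {s : ℝ | T (-s) x ∈ A} = 1) :
    ((μ.restrict A).prod volume).map (fun q : X × ℝ => T q.2 q.1) = μ := by
  have hTs : ∀ s, Measurable (T s) := fun s => hT.comp (measurable_id.prodMk measurable_const)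
  have hT' : Measurable fun q : X × ℝ => T (-q.2) q.1 :=
    hT.comp (measurable_fst.prodMk measurable_snd.neg)
  ext B hB
  rw [Measure.map_apply hT hB, Measure.prod_apply_symm (hT hB)]
  have h1 : ∀ s : ℝ, (μ.restrict A) ((fun x => (x, s)) ⁻¹' ((fun q : X × ℝ => T q.2 q.1) ⁻¹' B))
      = μ ((fun x => (x, s)) ⁻¹' {q : X × ℝ | q.1 ∈ B ∧ T (-q.2) q.1 ∈ A}) := by
    intro s
    have hm : MeasurableSet {x | x ∈ B ∧ T (-s) x ∈ A} := hB.inter (hTs _ hA)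
    change (μ.restrict A) (T s ⁻¹' B) = _
    rw [Measure.restrict_apply (hTs s hB)]
    nth_rw 2 [← hinv s]
    change _ = (μ.map (T s)) {x | x ∈ B ∧ T (-s) x ∈ A}
    rw [Measure.map_apply (hTs s) hm]
    congr 1
    ext x
    simp [hneg]
  have hm : MeasurableSet {q : X × ℝ | q.1 ∈ B ∧ T (-q.2) q.1 ∈ A} :=
    (measurable_fst hB).inter (hT' hA)
  simp_rw [h1]
  rw [← Measure.prod_apply_symm hm, Measure.prod_apply hm, ← lintegral_indicator_one hB]
  refine lintegral_congr_ae ?_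
  filter_upwards [hvol] with x hx
  by_cases hxB : x ∈ B
  · simpa [hxB] using hx
  · simp [hxB]

/-- Integration along the orbits of a measure-preserving flow. -/
theorem integral_eq_setIntegral_integral_flow {X : Type*} [MeasurableSpace X] (μ : Measure X)
    [SFinite μ] (T : ℝ → X → X) (hT : Measurable fun q : X × ℝ => T q.2 q.1)
    (hinv : ∀ s, μ.map (T s) = μ) (hneg : ∀ s x, T (-s) (T s x) = x) {A : Set X}
    (hA : MeasurableSet A) (hμA : μ A ≠ ⊤) (hvol : ∀ᵐ x ∂μ, volume {s : ℝ | T (-s) x ∈ A} = 1)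
    {F : X → ℝ} (hF : Measurable F) {g : ℝ → ℝ} (hg : Integrable g)
    (hFg : ∀ x ∈ A, ∀ s, |F (T s x)| ≤ g s) :
    ∫ x, F x ∂μ = ∫ x in A, (∫ s, F (T s x)) ∂μ := by
  have : IsFiniteMeasure (μ.restrict A) := ⟨by simpa using hμA.lt_top⟩
  nth_rw 1 [← map_flow_restrict_prod μ T hT hinv hneg hA hvol]
  rw [integral_map hT.aemeasurable hF.aestronglyMeasurable]
  refine integral_prod (fun q : X × ℝ => F (T q.2 q.1)) ?_
  refine (hg.comp_snd (μ.restrict A)).mono' (hF.comp hT).aestronglyMeasurable ?_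
  have : ∀ᵐ q ∂((μ.restrict A).prod (volume : Measure ℝ)), q.1 ∈ A :=
    Measure.quasiMeasurePreserving_fst.ae (ae_restrict_mem hA)
  filter_upwards [this] with q hq using hFg _ hq _

/-- The anisotropic dilations `(z, σ) ↦ (eˢ z, e^{(α+1)s} σ)`. -/
def dil (α s : ℝ) (x : Euc m × Euc k) : Euc m × Euc k :=
  (exp s • x.1, exp ((α + 1) * s) • x.2)

lemma dil_neg_dil (α s : ℝ) (x : Euc m × Euc k) : dil α (-s) (dil α s x) = x := by
  simp [dil, smul_smul, ← exp_add]

lemma continuous_dil (α : ℝ) :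
    Continuous fun q : (Euc m × Euc k) × ℝ => dil α q.2 q.1 := by
  unfold dil
  fun_prop

lemma continuous_dil_right (α s : ℝ) : Continuous (dil α s : Euc m × Euc k → _) := by
  unfold dil
  fun_prop

lemma map_dil_volume (α s : ℝ) :
    (volume : Measure (Euc m × Euc k)).map (dil α s) =
      ENNReal.ofReal (exp (-((m + (α + 1) * k) * s))) • volume := by
  have h1 : (volume : Measure (Euc m)).map (exp s • ·) =
      ENNReal.ofReal (exp (-(m * s))) • volume := by
    rw [Measure.map_addHaar_smul _ (exp_pos s).ne', finrank_euclideanSpace_fin,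
      abs_of_pos (by positivity), exp_neg, exp_nat_mul]
  have h2 : (volume : Measure (Euc k)).map (exp ((α + 1) * s) • ·) =
      ENNReal.ofReal (exp (-(k * ((α + 1) * s)))) • volume := by
    rw [Measure.map_addHaar_smul _ (exp_pos _).ne', finrank_euclideanSpace_fin,
      abs_of_pos (by positivity), exp_neg, exp_nat_mul]
  change ((volume : Measure (Euc m)).prod (volume : Measure (Euc k))).map
    (Prod.map (exp s • ·) (exp ((α + 1) * s) • ·)) = _
  rw [← Measure.map_prod_map _ _ (measurable_const_smul _) (measurable_const_smul _), h1, h2,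
    Measure.prod_smul_left, Measure.prod_smul_right, smul_smul,
    ← ENNReal.ofReal_mul (exp_pos _).le, ← exp_add]
  congr 4
  ring

variable {Φ : Euc m → ℝ} {Ψ : Euc k → ℝ} {α : ℝ}

lemma rho_nonneg (x : Euc m × Euc k) (hΦ : IsGauge (dualNorm Φ)) : 0 ≤ rho α Φ Ψ x := by
  have := hΦ.nonneg x.1
  unfold rho
  positivity

lemma rho_rpow (hα : 0 < α) (hΦ : IsGauge (dualNorm Φ)) (x : Euc m × Euc k) :
    rho α Φ Ψ x ^ (2 * (α + 1)) =
      dualNorm Φ x.1 ^ (2 * (α + 1)) + 4 * (α + 1) ^ 2 * dualNorm Ψ x.2 ^ 2 := by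
  have := hΦ.nonneg x.1
  rw [rho, ← rpow_mul (by positivity), one_div_mul_cancel (by positivity), rpow_one]

lemma continuous_rho (hα : 0 < α) (hΦ : IsGauge (dualNorm Φ)) (hΨ : IsGauge (dualNorm Ψ)) :
    Continuous (rho α Φ Ψ) := by
  have h1 := hΦ.continuous
  have h2 := hΨ.continuous
  unfold rho
  refine Continuous.rpow_const (Continuous.add (Continuous.rpow_const (by fun_prop) ?_)
    (by fun_prop)) ?_ <;> intro <;> right <;> positivity

lemma rho_dil (hα : 0 < α) (hΦ : IsGauge (dualNorm Φ)) (hΨ : IsGauge (dualNorm Ψ)) (s : ℝ)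
    (x : Euc m × Euc k) : rho α Φ Ψ (dil α s x) = exp s * rho α Φ Ψ x := by
  have h1 := hΦ.nonneg x.1
  have h2 : exp s = (exp s ^ (2 * (α + 1))) ^ (1 / (2 * (α + 1))) := by
    rw [← rpow_mul (exp_pos s).le, mul_one_div_cancel (by positivity), rpow_one]
  have h3 : exp ((α + 1) * s) ^ 2 = exp s ^ (2 * (α + 1)) := by
    rw [← exp_mul, ← exp_nat_mul]; congr 1; push_cast; ring
  rw [rho, rho, h2, ← mul_rpow (by positivity) (by positivity)]
  simp only [dil, hΦ.smul _ (exp_pos _).le, hΨ.smul _ (exp_pos _).le]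
  rw [mul_rpow (exp_pos _).le h1, mul_pow, h3]
  congr 1
  ring

lemma dualNorm_fst_le_rho (hα : 0 < α) (hΦ : IsGauge (dualNorm Φ)) (x : Euc m × Euc k) :
    dualNorm Φ x.1 ≤ rho α Φ Ψ x := by
  have h := rho_rpow (Ψ := Ψ) hα hΦ x
  rw [← rpow_le_rpow_iff (hΦ.nonneg _) (rho_nonneg x hΦ) (show 0 < 2 * (α + 1) by positivity), h]
  have : 0 ≤ 4 * (α + 1) ^ 2 * dualNorm Ψ x.2 ^ 2 := by positivity
  linarith

lemma dualNorm_snd_le_rho (hα : 0 < α) (hΦ : IsGauge (dualNorm Φ))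
    (x : Euc m × Euc k) : dualNorm Ψ x.2 ≤ rho α Φ Ψ x ^ (α + 1) := by
  have h := rho_rpow (Ψ := Ψ) hα hΦ x
  have h0 := rho_nonneg (α := α) (Ψ := Ψ) x hΦ
  have h1 : 0 ≤ dualNorm Φ x.1 ^ (2 * (α + 1)) := rpow_nonneg (hΦ.nonneg _) _
  rw [mul_comm 2 (α + 1), rpow_mul h0, mul_comm (α + 1) 2, rpow_two] at h
  refine le_of_sq_le_sq ?_ (by positivity)
  nlinarith [mul_nonneg (by positivity : 0 ≤ 4 * (α ^ 2 + 2 * α) + 3) (sq_nonneg (dualNorm Ψ x.2))]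

lemma rho_pos_of_fst (hα : 0 < α) (hΦ : IsGauge (dualNorm Φ)) {x : Euc m × Euc k}
    (hx : x.1 ≠ 0) : 0 < rho α Φ Ψ x :=
  (hΦ.pos _ hx).trans_le (dualNorm_fst_le_rho hα hΦ x)

lemma exists_norm_le_of_rho_le (hm : 1 ≤ m) (hk : 1 ≤ k) (hα : 0 < α)
    (hΦ : IsGauge (dualNorm Φ)) (hΨ : IsGauge (dualNorm Ψ)) (r : ℝ) :
    ∃ R, 0 < R ∧ ∀ x, rho α Φ Ψ x ≤ r → ‖x‖ ≤ R := by
  obtain ⟨c, hc, h1⟩ := hΦ.exists_mul_norm_le hm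
  obtain ⟨d, hd, h2⟩ := hΨ.exists_mul_norm_le hk
  refine ⟨max 1 (max (r / c) (r ^ (α + 1) / d)), by positivity, fun x hx => ?_⟩
  refine le_max_of_le_right ?_
  rw [Prod.norm_def]
  refine max_le_max ?_ ?_
  · rw [le_div_iff₀ hc, mul_comm]
    exact (h1 _).trans ((dualNorm_fst_le_rho hα hΦ x).trans hx)
  · rw [le_div_iff₀ hd, mul_comm]
    refine (h2 _).trans ((dualNorm_snd_le_rho hα hΦ x).trans ?_)
    exact rpow_le_rpow (rho_nonneg x hΦ) hx (by positivity)

lemma ae_fst_ne_zero (hm : 1 ≤ m) : ∀ᵐ x : Euc m × Euc k, x.1 ≠ 0 := by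
  have : Nonempty (Fin m) := ⟨⟨0, hm⟩⟩
  exact Measure.quasiMeasurePreserving_fst.ae (Measure.ae_ne volume (0 : Euc m))

/-- The density `Φ⁰(z)^{αp} ρ^{-(Q+αp)}`, homogeneous of degree `-Q` under the dilations. -/
def homDensity (α p Q : ℝ) (Φ : Euc m → ℝ) (Ψ : Euc k → ℝ) (x : Euc m × Euc k) : ℝ :=
  dualNorm Φ x.1 ^ (α * p) * rho α Φ Ψ x ^ (-(Q + α * p))

variable {p Q : ℝ}

lemma homDensity_nonneg (hΦ : IsGauge (dualNorm Φ)) (x : Euc m × Euc k) :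
    0 ≤ homDensity α p Q Φ Ψ x :=
  mul_nonneg (rpow_nonneg (hΦ.nonneg _) _) (rpow_nonneg (rho_nonneg x hΦ) _)

lemma homDensity_pos (hα : 0 < α) (hΦ : IsGauge (dualNorm Φ)) {x : Euc m × Euc k}
    (hx : x.1 ≠ 0) : 0 < homDensity α p Q Φ Ψ x :=
  mul_pos (rpow_pos_of_pos (hΦ.pos _ hx) _) (rpow_pos_of_pos (rho_pos_of_fst hα hΦ hx) _)

lemma measurable_homDensity (hα : 0 < α) (hΦ : IsGauge (dualNorm Φ))
    (hΨ : IsGauge (dualNorm Ψ)) : Measurable (homDensity α p Q Φ Ψ) := by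
  have h1 := hΦ.continuous.measurable
  have h2 := (continuous_rho hα hΦ hΨ).measurable
  unfold homDensity
  fun_prop

lemma homDensity_dil (hα : 0 < α) (hΦ : IsGauge (dualNorm Φ)) (hΨ : IsGauge (dualNorm Ψ)) (s : ℝ)
    (x : Euc m × Euc k) :
    homDensity α p Q Φ Ψ x = exp (Q * s) * homDensity α p Q Φ Ψ (dil α s x) := by
  rw [homDensity, homDensity, rho_dil hα hΦ hΨ]
  simp only [dil, hΦ.smul _ (exp_pos _).le]
  rw [mul_rpow (exp_pos _).le (hΦ.nonneg _), mul_rpow (exp_pos _).le (rho_nonneg x hΦ),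
    ← exp_mul, ← exp_mul]
  have : exp (Q * s) * exp (s * (α * p)) * exp (s * -(Q + α * p)) = 1 := by
    rw [← exp_add, ← exp_add, exp_eq_one_iff]; ring
  linear_combination (-(dualNorm Φ x.1 ^ (α * p) * rho α Φ Ψ x ^ (-(Q + α * p)))) * this

/-- The dilation-invariant measure with density `homDensity`. -/
def homMeasure (α p Q : ℝ) (Φ : Euc m → ℝ) (Ψ : Euc k → ℝ) : Measure (Euc m × Euc k) :=
  volume.withDensity fun x => ENNReal.ofReal (homDensity α p Q Φ Ψ x)

instance : SFinite (homMeasure α p Q Φ Ψ) := by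
  unfold homMeasure
  infer_instance

lemma map_dil_homMeasure (hα : 0 < α) (hΦ : IsGauge (dualNorm Φ)) (hΨ : IsGauge (dualNorm Ψ))
    (hQ : Q = m + (α + 1) * k) (s : ℝ) :
    (homMeasure α p Q Φ Ψ).map (dil α s) = homMeasure α p Q Φ Ψ := by
  have hd := (continuous_dil_right (m := m) (k := k) α s).measurable
  have hmeas : Measurable fun x => ENNReal.ofReal (homDensity α p Q Φ Ψ x) :=
    (measurable_homDensity hα hΦ hΨ).ennreal_ofReal
  ext B hB
  rw [Measure.map_apply hd hB, homMeasure, withDensity_apply _ (hd hB), withDensity_apply _ hB]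
  have hscale : ∀ x, ENNReal.ofReal (homDensity α p Q Φ Ψ x) =
      ENNReal.ofReal (exp (Q * s)) * ENNReal.ofReal (homDensity α p Q Φ Ψ (dil α s x)) :=
    fun x => by
    rw [homDensity_dil hα hΦ hΨ s x, ENNReal.ofReal_mul (exp_pos _).le]
  rw [lintegral_congr hscale, lintegral_const_mul' _ _ ENNReal.ofReal_ne_top,
    ← setLIntegral_map hB hmeas hd, map_dil_volume,
    Measure.restrict_smul, lintegral_smul_measure, smul_eq_mul, ← mul_assoc,
    ← ENNReal.ofReal_mul (exp_pos _).le, ← exp_add, ← hQ]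
  simp

/-- The dilation shell `1 ≤ ρ < e`, a fundamental domain for unit dilation time. -/
def shell (α : ℝ) (Φ : Euc m → ℝ) (Ψ : Euc k → ℝ) : Set (Euc m × Euc k) :=
  {x | 1 ≤ rho α Φ Ψ x ∧ rho α Φ Ψ x < exp 1}

lemma measurableSet_shell (hα : 0 < α) (hΦ : IsGauge (dualNorm Φ)) (hΨ : IsGauge (dualNorm Ψ)) :
    MeasurableSet (shell α Φ Ψ) :=
  have h := (continuous_rho hα hΦ hΨ).measurable
  (measurableSet_le measurable_const h).inter (measurableSet_lt h measurable_const)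

lemma volume_dil_mem_shell (hm : 1 ≤ m) (hα : 0 < α) (hΦ : IsGauge (dualNorm Φ))
    (hΨ : IsGauge (dualNorm Ψ)) :
    ∀ᵐ x ∂homMeasure α p Q Φ Ψ, volume {s : ℝ | dil α (-s) x ∈ shell α Φ Ψ} = 1 := by
  refine (withDensity_absolutelyContinuous _ _).ae_le ?_
  filter_upwards [ae_fst_ne_zero hm] with x hx
  have hpos : 0 < rho α Φ Ψ x := rho_pos_of_fst hα hΦ hx
  have : {s : ℝ | dil α (-s) x ∈ shell α Φ Ψ} =
      Set.Ioc (log (rho α Φ Ψ x) - 1) (log (rho α Φ Ψ x)) := by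
    ext s
    simp only [shell, Set.mem_ofPred_eq, rho_dil hα hΦ hΨ, Set.mem_Ioc]
    nth_rw 1 [← exp_log hpos]
    nth_rw 2 [← exp_log hpos]
    rw [← exp_add, one_le_exp_iff, exp_lt_exp]
    constructor <;> rintro ⟨h1, h2⟩ <;> constructor <;> linarith
  rw [this, Real.volume_Ioc]
  simp

lemma homMeasure_shell_ne_top (hm : 1 ≤ m) (hk : 1 ≤ k) (hα : 0 < α) (hp : 0 < p) (hQ : 0 ≤ Q)
    (hΦ : IsGauge (dualNorm Φ)) (hΨ : IsGauge (dualNorm Ψ)) :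
    homMeasure α p Q Φ Ψ (shell α Φ Ψ) ≠ ⊤ := by
  obtain ⟨R, -, hR⟩ := exists_norm_le_of_rho_le hm hk hα hΦ hΨ (exp 1)
  have hA := measurableSet_shell hα hΦ hΨ
  rw [homMeasure, withDensity_apply _ hA]
  have hle : ∫⁻ x in shell α Φ Ψ, ENNReal.ofReal (homDensity α p Q Φ Ψ x) ≤
      ∫⁻ x in shell α Φ Ψ, 1 := by
    refine setLIntegral_mono measurable_const fun x hx => ?_
    rw [ENNReal.ofReal_le_one, homDensity]
    have h0 : 0 < rho α Φ Ψ x := one_pos.trans_le hx.1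
    calc dualNorm Φ x.1 ^ (α * p) * rho α Φ Ψ x ^ (-(Q + α * p))
        ≤ rho α Φ Ψ x ^ (α * p) * rho α Φ Ψ x ^ (-(Q + α * p)) := by
          gcongr
          · exact hΦ.nonneg _
          · exact dualNorm_fst_le_rho hα hΦ x
      _ = rho α Φ Ψ x ^ (-Q) := by rw [← rpow_add h0]; congr 1; ring
      _ ≤ 1 := rpow_le_one_of_one_le_of_nonpos hx.1 (by linarith)
  refine (hle.trans_lt ?_).ne
  rw [setLIntegral_one]
  refine (measure_mono fun x hx => ?_).trans_lt
    (measure_closedBall_lt_top (x := (0 : Euc m × Euc k)) (r := R))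
  simpa using hR x hx.2.le

lemma homMeasure_shell_ne_zero (hm : 1 ≤ m) (hα : 0 < α) (hΦ : IsGauge (dualNorm Φ))
    (hΨ : IsGauge (dualNorm Ψ)) (hQ : Q = m + (α + 1) * k) :
    homMeasure α p Q Φ Ψ (shell α Φ Ψ) ≠ 0 := by
  intro h0
  have h1 := map_flow_restrict_prod (homMeasure α p Q Φ Ψ) (dil α)
    (continuous_dil α).measurable (map_dil_homMeasure hα hΦ hΨ hQ) (dil_neg_dil α)
    (measurableSet_shell hα hΦ hΨ) (volume_dil_mem_shell hm hα hΦ hΨ)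
  rw [Measure.restrict_eq_zero.2 h0, Measure.zero_prod, Measure.map_zero, eq_comm, homMeasure,
    withDensity_eq_zero_iff (measurable_homDensity hα hΦ hΨ).ennreal_ofReal.aemeasurable] at h1
  have h2 : ∀ᵐ x : Euc m × Euc k, False := by
    filter_upwards [h1, ae_fst_ne_zero hm] with x hx hx'
    have := homDensity_pos (p := p) (Q := Q) (Ψ := Ψ) hα hΦ hx'
    simp only [Pi.zero_apply, ENNReal.ofReal_eq_zero] at hx
    linarith
  simp only [Filter.eventually_false_iff_eq_bot, ae_eq_bot] at h2
  exact NeZero.ne _ h2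

lemma integral_homMeasure_eq_shell (hm : 1 ≤ m) (hk : 1 ≤ k) (hα : 0 < α) (hp : 0 < p)
    (hQ : Q = m + (α + 1) * k) (hΦ : IsGauge (dualNorm Φ)) (hΨ : IsGauge (dualNorm Ψ))
    {F : Euc m × Euc k → ℝ} (hF : Measurable F) {g : ℝ → ℝ} (hg : Integrable g)
    (hFg : ∀ x ∈ shell α Φ Ψ, ∀ s, |F (dil α s x)| ≤ g s) {c : ℝ}
    (hc : ∀ x ∈ shell α Φ Ψ, ∫ s, F (dil α s x) = c) :
    ∫ x, homDensity α p Q Φ Ψ x * F x = (homMeasure α p Q Φ Ψ).real (shell α Φ Ψ) * c := by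
  have hQ0 : 0 ≤ Q := by rw [hQ]; positivity
  have h1 : ∫ x, homDensity α p Q Φ Ψ x * F x = ∫ x, F x ∂homMeasure α p Q Φ Ψ := by
    rw [homMeasure, integral_withDensity_eq_integral_toReal_smul
      (measurable_homDensity hα hΦ hΨ).ennreal_ofReal (.of_forall fun _ => ENNReal.ofReal_lt_top)]
    simp only [ENNReal.toReal_ofReal (homDensity_nonneg hΦ _), smul_eq_mul]
  rw [h1, integral_eq_setIntegral_integral_flow _ (dil α) (continuous_dil α).measurable
    (map_dil_homMeasure hα hΦ hΨ hQ) (dil_neg_dil α) (measurableSet_shell hα hΦ hΨ)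
    (homMeasure_shell_ne_top hm hk hα hp hQ0 hΦ hΨ) (volume_dil_mem_shell hm hα hΦ hΨ) hF hg hFg,
    setIntegral_congr_fun (measurableSet_shell hα hΦ hΨ) hc, setIntegral_const, smul_eq_mul]

lemma setIntegral_rho_lt_one (hm : 1 ≤ m) (hk : 1 ≤ k) (hα : 0 < α) (hp : 0 < p) (hQ0 : 0 < Q)
    (hQ : Q = m + (α + 1) * k) (hΦ : IsGauge (dualNorm Φ)) (hΨ : IsGauge (dualNorm Ψ)) :
    ∫ x in {x | rho α Φ Ψ x < 1}, (dualNorm Φ x.1 / rho α Φ Ψ x) ^ (α * p) =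
      (homMeasure α p Q Φ Ψ).real (shell α Φ Ψ) * Q⁻¹ := by
  have hρ := (continuous_rho hα hΦ hΨ).measurable
  have hS : MeasurableSet {x | rho α Φ Ψ x < 1} := measurableSet_lt hρ measurable_const
  have hrpow : Measurable fun x => rho α Φ Ψ x ^ Q := by fun_prop
  have hflow : ∀ x ∈ shell α Φ Ψ, ∀ s, {x | rho α Φ Ψ x < 1}.indicator
      (fun x => rho α Φ Ψ x ^ Q) (dil α s x) = (Set.Iio (-log (rho α Φ Ψ x))).indicator
        (fun s => rho α Φ Ψ x ^ Q * exp (Q * s)) s := by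
    intro x hx s
    have h0 : 0 < rho α Φ Ψ x := one_pos.trans_le hx.1
    have hiff : dil α s x ∈ {x | rho α Φ Ψ x < 1} ↔ s ∈ Set.Iio (-log (rho α Φ Ψ x)) := by
      simp only [Set.mem_ofPred_eq, rho_dil hα hΦ hΨ, Set.mem_Iio]
      nth_rw 1 [← exp_log h0]
      rw [← exp_add, exp_lt_one_iff, lt_neg_iff_add_neg]
    simp only [Set.indicator, hiff]
    rw [rho_dil hα hΦ hΨ, mul_rpow (exp_pos _).le h0.le, ← exp_mul, mul_comm s, mul_comm]
  rw [← integral_homMeasure_eq_shell hm hk hα hp hQ hΦ hΨ (hrpow.indicator hS)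
    (g := (Set.Iic 0).indicator fun s => exp 1 ^ Q * exp (Q * s)) (c := Q⁻¹),
    ← integral_indicator hS]
  · refine integral_congr_ae ?_
    filter_upwards [ae_fst_ne_zero hm] with x hx
    by_cases hxS : x ∈ {x | rho α Φ Ψ x < 1}
    · have h0 : 0 < rho α Φ Ψ x := rho_pos_of_fst hα hΦ hx
      rw [Set.indicator_of_mem hxS, Set.indicator_of_mem hxS, homDensity, mul_assoc,
        ← rpow_add h0, div_rpow (hΦ.nonneg _) h0.le, div_eq_mul_inv, ← rpow_neg h0.le]
      congr 2
      ring
    · rw [Set.indicator_of_notMem hxS, Set.indicator_of_notMem hxS, mul_zero]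
  · exact (integrable_indicator_iff measurableSet_Iic).2
      ((integrableOn_exp_mul_Iic hQ0 0).const_mul _)
  · intro x hx s
    have h0 : 0 < rho α Φ Ψ x := one_pos.trans_le hx.1
    have hlog : 0 ≤ log (rho α Φ Ψ x) := log_nonneg hx.1
    rw [hflow x hx s]
    by_cases hs : s ∈ Set.Iio (-log (rho α Φ Ψ x))
    · have hs0 : s ∈ Set.Iic (0 : ℝ) := by
        simp only [Set.mem_Iio, Set.mem_Iic] at hs ⊢
        linarith
      rw [Set.indicator_of_mem hs, Set.indicator_of_mem hs0, abs_of_nonneg (by positivity)]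
      have := rpow_le_rpow h0.le hx.2.le hQ0.le
      gcongr
    · rw [Set.indicator_of_notMem hs, abs_zero]
      exact Set.indicator_nonneg (fun _ _ => by positivity) _
  · intro x hx
    have h0 : 0 < rho α Φ Ψ x := one_pos.trans_le hx.1
    simp only [hflow x hx]
    rw [integral_indicator measurableSet_Iio, integral_const_mul, ← integral_Iic_eq_integral_Iio,
      integral_exp_mul_Iic hQ0]
    nth_rw 1 [← exp_log h0]
    rw [← exp_mul, ← mul_div_assoc, ← exp_add]
    simp [mul_comm]

lemma hasDerivAt_dil (α s : ℝ) (x : Euc m × Euc k) :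
    HasDerivAt (fun s => dil α s x) ((dil α s x).1, (α + 1) • (dil α s x).2) s := by
  have h1 : HasDerivAt (fun s => exp s • x.1) (exp s • x.1) s :=
    (Real.hasDerivAt_exp s).smul_const _
  have h2 : HasDerivAt (fun s => exp ((α + 1) * s) • x.2)
      ((α + 1) • exp ((α + 1) * s) • x.2) s := by
    refine (((hasDerivAt_id s).const_mul (α + 1)).exp.smul_const x.2).congr_deriv ?_
    simp [smul_smul, mul_comm]
  exact h1.prodMk h2

lemma integral_homDensity_mul_fderiv (hm : 1 ≤ m) (hk : 1 ≤ k) (hα : 0 < α) (hp : 0 < p)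
    (hQ : Q = m + (α + 1) * k) (hΦ : IsGauge (dualNorm Φ)) (hΨ : IsGauge (dualNorm Ψ))
    {φ : Euc m × Euc k → ℝ} (hφ : ContDiff ℝ 1 φ) (hφc : HasCompactSupport φ) :
    ∫ x, homDensity α p Q Φ Ψ x * fderiv ℝ φ x (x.1, (α + 1) • x.2) =
      (homMeasure α p Q Φ Ψ).real (shell α Φ Ψ) * (-φ 0) := by
  have hφ' : Continuous (fderiv ℝ φ) := hφ.continuous_fderiv one_ne_zero
  obtain ⟨M, hM⟩ := hφ'.bounded_above_of_compact_support (hφc.fderiv ℝ)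
  have hM0 : 0 ≤ M := (norm_nonneg _).trans (hM 0)
  obtain ⟨R, hR0, hR⟩ := exists_norm_le_of_rho_le hm hk hα hΦ hΨ (exp 1)
  obtain ⟨r, hr0, hr⟩ : ∃ r, 0 < r ∧ ∀ x ∈ tsupport φ, rho α Φ Ψ x ≤ r := by
    obtain ⟨r, hr0, hr⟩ :=
    (hφc.isCompact.image (continuous_rho hα hΦ hΨ)).isBounded.exists_pos_norm_le
    exact ⟨r, hr0, fun x hx => (le_abs_self _).trans (hr _ ⟨x, hx, rfl⟩)⟩
  have hout : ∀ x ∈ shell α Φ Ψ, ∀ s, log r < s → dil α s x ∉ tsupport φ := by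
    intro x hx s hs hmem
    have h1 := hr _ hmem
    rw [rho_dil hα hΦ hΨ] at h1
    have h2 : r < exp s := (log_lt_iff_lt_exp hr0).1 hs
    nlinarith [hx.1, exp_pos s]
  have hα1 : 0 < α + 1 := by linarith
  have hbound : ∀ x ∈ shell α Φ Ψ, ∀ s,
      |fderiv ℝ φ (dil α s x) ((dil α s x).1, (α + 1) • (dil α s x).2)| ≤
        (Set.Iic (log r)).indicator
          (fun s => M * (R * exp (1 * s) + (α + 1) * R * exp ((α + 1) * s))) s := by
    intro x hx s
    by_cases hs : s ∈ Set.Iic (log r)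
    · rw [Set.indicator_of_mem hs]
      refine ((fderiv ℝ φ (dil α s x)).le_opNorm _).trans ?_
      refine mul_le_mul (hM _) ?_ (norm_nonneg _) hM0
      have hx' := hR x hx.2.le
      have hx1 : ‖x.1‖ ≤ R := (norm_fst_le x).trans hx'
      have hx2 : ‖x.2‖ ≤ R := (norm_snd_le x).trans hx'
      refine (Prod.norm_def _).trans_le (max_le ?_ ?_)
      · simp only [dil, norm_smul, norm_eq_abs, abs_exp, one_mul]
        have : 0 ≤ (α + 1) * R * exp ((α + 1) * s) := by positivity
        nlinarith [exp_pos s]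
      · simp only [dil, norm_smul, norm_eq_abs, abs_exp, one_mul, abs_of_pos hα1]
        have : 0 ≤ R * exp s := by positivity
        have : (α + 1) * (exp ((α + 1) * s) * ‖x.2‖) ≤ (α + 1) * (exp ((α + 1) * s) * R) := by
          gcongr
        linarith
    · rw [Set.indicator_of_notMem hs]
      have h0 : fderiv ℝ φ (dil α s x) = 0 :=
        image_eq_zero_of_notMem_tsupport fun h =>
          hout x hx s (not_le.1 hs) (tsupport_fderiv_subset ℝ h)
      simp [h0]
  have hg_int : Integrable ((Set.Iic (log r)).indicator
      (fun s => M * (R * exp (1 * s) + (α + 1) * R * exp ((α + 1) * s)))) :=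
    (integrable_indicator_iff measurableSet_Iic).2
      ((((integrableOn_exp_mul_Iic one_pos _).const_mul _).add
        ((integrableOn_exp_mul_Iic hα1 _).const_mul _)).const_mul _)
  have hcont : Continuous fun x : Euc m × Euc k => fderiv ℝ φ x (x.1, (α + 1) • x.2) :=
    hφ'.clm_apply (by fun_prop)
  refine integral_homMeasure_eq_shell hm hk hα hp hQ hΦ hΨ hcont.measurable hg_int hbound ?_
  intro x hx
  have hdil : Continuous fun s => dil α s x := by
    unfold dil
    fun_prop
  rw [← zero_sub]
  refine integral_of_hasDerivAt_of_tendsto (f := fun s => φ (dil α s x)) (fun s => ?_) ?_ ?_ ?_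
  · exact ((hφ.differentiable one_ne_zero).differentiableAt.hasFDerivAt).comp_hasDerivAt s
      (hasDerivAt_dil α s x)
  · exact hg_int.mono' (hcont.comp hdil).aestronglyMeasurable (.of_forall (hbound x hx))
  · refine (hφ.continuous.tendsto 0).comp ?_
    have h1 : Filter.Tendsto (fun s => exp s • x.1) .atBot (nhds ((0 : ℝ) • x.1)) :=
      tendsto_exp_atBot.smul_const _
    have h2 : Filter.Tendsto (fun s => exp ((α + 1) * s) • x.2) .atBot (nhds ((0 : ℝ) • x.2)) :=
      (tendsto_exp_atBot.comp (Filter.tendsto_id.const_mul_atBot hα1)).smul_const _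
    rw [zero_smul] at h1 h2
    exact h1.prodMk_nhds h2
  · refine tendsto_const_nhds.congr' ?_
    filter_upwards [Filter.eventually_gt_atTop (log r)] with s hs
    exact (image_eq_zero_of_notMem_tsupport (hout x hx s hs)).symm

lemma hasDerivAt_mul_rpow_rpow {W : ℝ → ℝ} {W' t β : ℝ} (K γ : ℝ) (hW : HasDerivAt W W' t)
    (h0 : 0 < W t) (hβ : 0 < β) :
    HasDerivAt (fun t => K * (W t ^ (1 / β)) ^ (-γ))
      (-(K * γ * (W t ^ (1 / β)) ^ (-γ - β)) * (W' / β)) t := by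
  have hR : 0 < W t ^ (1 / β) := rpow_pos_of_pos h0 _
  refine (((hW.rpow_const (p := 1 / β) (.inl h0.ne')).rpow_const (p := -γ)
    (.inl hR.ne')).const_mul K).congr_deriv ?_
  have h2 : W t ^ (1 / β - 1) = (W t ^ (1 / β)) ^ (1 - β) := by
    rw [← rpow_mul h0.le]; congr 1; field_simp
  have h3 : (W t ^ (1 / β)) ^ (-γ - β) =
      (W t ^ (1 / β)) ^ (1 - β) * (W t ^ (1 / β)) ^ (-γ - 1) := by
    rw [← rpow_add hR]; congr 1; ring
  rw [h2, h3]
  ring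

lemma gradZ_mul_rho_rpow (hα : 0 < α) (hΦ : IsMinkowskiNorm Φ) (hm : 1 ≤ m)
    (K γ : ℝ) (σ₀ : Euc k) {G : Euc m × Euc k → ℝ}
    (hG : ∀ x, G x = K * rho α Φ Ψ (x.1, x.2 - σ₀) ^ (-γ)) {x : Euc m × Euc k} (hx : x.1 ≠ 0)
    {ξ : Euc m} (hξ : Φ ξ = 1) (hξx : ⟪x.1, ξ⟫ = dualNorm Φ x.1) :
    gradZ G x = (-(K * γ * rho α Φ Ψ (x.1, x.2 - σ₀) ^ (-γ - 2 * (α + 1))) *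
      dualNorm Φ x.1 ^ (2 * α + 1)) • ξ := by
  have ha := hΦ.dualNorm_pos hm hx
  have hβ : 0 < 2 * (α + 1) := by positivity
  have h1 : HasDerivAt (fun t => t ^ (2 * (α + 1)) + 4 * (α + 1) ^ 2 * dualNorm Ψ (x.2 - σ₀) ^ 2)
      (2 * (α + 1) * dualNorm Φ x.1 ^ (2 * (α + 1) - 1)) (dualNorm Φ x.1) :=
    (Real.hasDerivAt_rpow_const (.inl ha.ne')).add_const _
  have h2 := hasDerivAt_mul_rpow_rpow K γ h1 (by positivity) hβ
  have h3 := h2.comp_hasFDerivAt x.1 (hΦ.hasGradientAt_dualNorm hm hx hξ hξx).hasFDerivAt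
  refine HasGradientAt.gradient ?_
  rw [hasGradientAt_iff_hasFDerivAt, map_smul]
  refine (h3.congr_of_eventuallyEq (.of_forall fun z => hG (z, x.2))).congr_fderiv ?_
  rw [mul_div_cancel_left₀ _ hβ.ne', show 2 * (α + 1) - 1 = 2 * α + 1 by ring]
  rfl

lemma gradS_mul_rho_rpow (hα : 0 < α) (hΦ : IsGauge (dualNorm Φ)) (hΨ : IsMinkowskiNorm Ψ)
    (hk : 1 ≤ k) (K γ : ℝ) (σ₀ : Euc k) {G : Euc m × Euc k → ℝ}
    (hG : ∀ x, G x = K * rho α Φ Ψ (x.1, x.2 - σ₀) ^ (-γ)) {x : Euc m × Euc k} (hx : x.1 ≠ 0)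
    (hx2 : x.2 - σ₀ ≠ 0) {η : Euc k} (hη : Ψ η = 1)
    (hηx : ⟪x.2 - σ₀, η⟫ = dualNorm Ψ (x.2 - σ₀)) :
    gradS G x = (-(K * γ * rho α Φ Ψ (x.1, x.2 - σ₀) ^ (-γ - 2 * (α + 1))) *
      (4 * (α + 1) * dualNorm Ψ (x.2 - σ₀))) • η := by
  have ha := hΦ.pos _ hx
  have hβ : 0 < 2 * (α + 1) := by positivity
  have h1 : HasDerivAt (fun t => dualNorm Φ x.1 ^ (2 * (α + 1)) + 4 * (α + 1) ^ 2 * t ^ 2)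
      (4 * (α + 1) ^ 2 * (2 * dualNorm Ψ (x.2 - σ₀))) (dualNorm Ψ (x.2 - σ₀)) := by
    simpa using ((hasDerivAt_pow 2 (dualNorm Ψ (x.2 - σ₀))).const_mul
      (4 * (α + 1) ^ 2)).const_add (dualNorm Φ x.1 ^ (2 * (α + 1)))
  have h2 := hasDerivAt_mul_rpow_rpow K γ h1 (by positivity) hβ
  have h3 := h2.comp_hasFDerivAt (x.2 - σ₀)
    (hΨ.hasGradientAt_dualNorm hk hx2 hη hηx).hasFDerivAt
  refine HasGradientAt.gradient ?_
  rw [hasGradientAt_iff_hasFDerivAt, map_smul]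
  refine ((h3.comp x.2 ((hasFDerivAt_id x.2).sub_const σ₀)).congr_of_eventuallyEq
    (.of_forall fun σ => hG (x.1, σ))).congr_fderiv ?_
  rw [show 4 * (α + 1) ^ 2 * (2 * dualNorm Ψ (x.2 - σ₀)) / (2 * (α + 1)) =
    4 * (α + 1) * dualNorm Ψ (x.2 - σ₀) by field_simp]
  rfl

lemma inner_gradZ {φ : Euc m × Euc k → ℝ} {x : Euc m × Euc k} (hφ : DifferentiableAt ℝ φ x)
    (v : Euc m) : ⟪v, gradZ φ x⟫ = fderiv ℝ φ x (v, 0) := by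
  have h : HasFDerivAt (fun z => φ (z, x.2))
      ((fderiv ℝ φ x).comp (ContinuousLinearMap.inl ℝ _ _)) x.1 :=
    hφ.hasFDerivAt.comp x.1 (hasFDerivAt_prodMk_left x.1 x.2)
  rw [gradZ, real_inner_comm, inner_gradient_left, h.fderiv]
  rfl

lemma inner_gradS {φ : Euc m × Euc k → ℝ} {x : Euc m × Euc k} (hφ : DifferentiableAt ℝ φ x)
    (v : Euc k) : ⟪v, gradS φ x⟫ = fderiv ℝ φ x (0, v) := by
  have h : HasFDerivAt (fun σ => φ (x.1, σ))
      ((fderiv ℝ φ x).comp (ContinuousLinearMap.inr ℝ _ _)) x.2 :=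
    hφ.hasFDerivAt.comp x.2 (hasFDerivAt_prodMk_right x.1 x.2)
  rw [gradS, real_inner_comm, inner_gradient_left, h.fderiv]
  rfl

lemma rpow_energy_eq {a ρ B K γ : ℝ} (ha : 0 < a) (hρ : 0 < ρ)
    (hK : 0 < K * γ) (hγ : γ * (p - 1) = Q - p)
    (hB : ρ ^ (2 * (α + 1)) = a ^ (2 * (α + 1)) + 4 * (α + 1) ^ 2 * B ^ 2) :
    ((K * γ * ρ ^ (-γ - 2 * (α + 1)) * a ^ (2 * α + 1)) ^ 2 + a ^ (2 * α) / 4 *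
        (K * γ * ρ ^ (-γ - 2 * (α + 1)) * (4 * (α + 1) * B)) ^ 2) ^ ((p - 2) / 2) *
      (K * γ * ρ ^ (-γ - 2 * (α + 1)) * a ^ (2 * α)) =
      (K * γ) ^ (p - 1) * (a ^ (α * p) * ρ ^ (-(Q + α * p))) := by
  set c := K * γ * ρ ^ (-γ - 2 * (α + 1)) with hc
  have hc0 : 0 < c := by positivity
  have h1 : (c * a ^ (2 * α + 1)) ^ 2 + a ^ (2 * α) / 4 * (c * (4 * (α + 1) * B)) ^ 2 =
      c ^ 2 * (a ^ (2 * α) * ρ ^ (2 * (α + 1))) := by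
    have : (a ^ (2 * α + 1)) ^ 2 = a ^ (2 * α) * a ^ (2 * (α + 1)) := by
      rw [← rpow_natCast, ← rpow_mul ha.le, ← rpow_add ha]; congr 1; push_cast; ring
    rw [hB, mul_pow, this]
    ring
  have h2 : (c ^ 2 * (a ^ (2 * α) * ρ ^ (2 * (α + 1)))) ^ ((p - 2) / 2) =
      c ^ (p - 2) * (a ^ (α * (p - 2)) * ρ ^ ((α + 1) * (p - 2))) := by
    rw [mul_rpow (by positivity) (by positivity), mul_rpow (by positivity) (by positivity),
      ← rpow_natCast c, ← rpow_mul hc0.le, ← rpow_mul ha.le, ← rpow_mul hρ.le]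
    congr 2
    · push_cast; ring
    · congr 1; ring
    · congr 1; ring
  have h3 : c ^ (p - 2) * c = (K * γ) ^ (p - 1) * ρ ^ ((-γ - 2 * (α + 1)) * (p - 1)) := by
    rw [← rpow_add_one hc0.ne', show p - 2 + 1 = p - 1 by ring, hc,
      mul_rpow hK.le (by positivity), ← rpow_mul hρ.le]
  have h4 : a ^ (α * p) = a ^ (α * (p - 2)) * a ^ (2 * α) := by
    rw [← rpow_add ha]; congr 1; ring
  have h5 : ρ ^ (-(Q + α * p)) =
      ρ ^ ((-γ - 2 * (α + 1)) * (p - 1)) * ρ ^ ((α + 1) * (p - 2)) := by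
    rw [← rpow_add hρ]; congr 1; linear_combination hγ
  rw [h1, h2, h4, h5]
  linear_combination (a ^ (α * (p - 2)) * ρ ^ ((α + 1) * (p - 2)) * a ^ (2 * α)) * h3

lemma weak_integrand_eq (hm : 1 ≤ m) (hk : 1 ≤ k) (hα : 0 < α)
    (hΦ : IsMinkowskiNorm Φ) (hΨ : IsMinkowskiNorm Ψ) {K γ : ℝ} (hK : 0 < K * γ)
    (hγ : γ * (p - 1) = Q - p) (σ₀ : Euc k) {G : Euc m × Euc k → ℝ}
    (hG : ∀ x, G x = K * rho α Φ Ψ (x.1, x.2 - σ₀) ^ (-γ)) {x : Euc m × Euc k} (hx : x.1 ≠ 0)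
    (hx2 : x.2 - σ₀ ≠ 0) {φ : Euc m × Euc k → ℝ} (hφ : DifferentiableAt ℝ φ x) :
    (Φ (gradZ G x) ^ 2 + dualNorm Φ x.1 ^ (2 * α) / 4 * Ψ (gradS G x) ^ 2) ^ ((p - 2) / 2) *
        (Φ (gradZ G x) * ⟪gradient Φ (gradZ G x), gradZ φ x⟫ +
          dualNorm Φ x.1 ^ (2 * α) / 4 * Ψ (gradS G x) *
            ⟪gradient Ψ (gradS G x), gradS φ x⟫) =
      -((K * γ) ^ (p - 1) * (homDensity α p Q Φ Ψ (x.1, x.2 - σ₀) *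
        fderiv ℝ φ x (x.1, (α + 1) • (x.2 - σ₀)))) := by
  have hΦ' := hΦ.dualNorm_isGauge hm
  obtain ⟨ξ, hξ, hξx⟩ := hΦ.exists_inner_eq_dualNorm hm x.1
  obtain ⟨η, hη, hηx⟩ := hΨ.exists_inner_eq_dualNorm hk (x.2 - σ₀)
  have hξ0 : ξ ≠ 0 := by
    rintro rfl
    exact zero_ne_one (hΦ.isGauge.map_zero.symm.trans hξ)
  have hη0 : η ≠ 0 := by
    rintro rfl
    exact zero_ne_one (hΨ.isGauge.map_zero.symm.trans hη)
  have ha := hΦ.dualNorm_pos hm hx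
  have hb := hΨ.dualNorm_pos hk hx2
  have hρ : 0 < rho α Φ Ψ (x.1, x.2 - σ₀) := rho_pos_of_fst hα hΦ' hx
  have hE := rpow_energy_eq ha hρ hK hγ (rho_rpow hα hΦ' (x.1, x.2 - σ₀))
  set d := K * γ * rho α Φ Ψ (x.1, x.2 - σ₀) ^ (-γ - 2 * (α + 1)) with hd
  have hgZ := gradZ_mul_rho_rpow hα hΦ hm K γ σ₀ hG hx hξ hξx
  have hgS := gradS_mul_rho_rpow hα hΦ' hΨ hk K γ σ₀ hG hx hx2 hη hηx
  rw [← hd] at hgZ hgS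
  have hΦg : Φ (gradZ G x) ^ 2 = (d * dualNorm Φ x.1 ^ (2 * α + 1)) ^ 2 := by
    rw [hgZ, hΦ.2.1, hξ, mul_one, sq_abs, neg_mul, neg_sq]
  have hΨg : Ψ (gradS G x) ^ 2 = (d * (4 * (α + 1) * dualNorm Ψ (x.2 - σ₀))) ^ 2 := by
    rw [hgS, hΨ.2.1, hη, mul_one, sq_abs, neg_mul, neg_sq]
  have hZ : Φ (gradZ G x) * ⟪gradient Φ (gradZ G x), gradZ φ x⟫ =
      -(d * dualNorm Φ x.1 ^ (2 * α)) * fderiv ℝ φ x (x.1, 0) := by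
    rw [← real_inner_smul_left, hgZ, hΦ.smul_gradient_smul hξ0, hξ, one_smul,
      hΦ.gradient_eq_of_inner_eq hm hx hξ hξx, real_inner_smul_left, real_inner_smul_left,
      inner_gradZ hφ, rpow_add_one ha.ne']
    field_simp
  have hS : Ψ (gradS G x) * ⟪gradient Ψ (gradS G x), gradS φ x⟫ =
      -(d * (4 * (α + 1))) * fderiv ℝ φ x (0, x.2 - σ₀) := by
    rw [← real_inner_smul_left, hgS, hΨ.smul_gradient_smul hη0, hη, one_smul,
      hΨ.gradient_eq_of_inner_eq hk hx2 hη hηx, real_inner_smul_left, real_inner_smul_left,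
      inner_gradS hφ]
    field_simp
  have hD : fderiv ℝ φ x (x.1, (α + 1) • (x.2 - σ₀)) =
      fderiv ℝ φ x (x.1, 0) + (α + 1) * fderiv ℝ φ x (0, x.2 - σ₀) := by
    rw [← smul_eq_mul, ← map_smul, ← map_add]
    simp
  rw [homDensity, ← mul_assoc, ← hE, hD, hΦg, hΨg, hZ, mul_assoc (_ / 4), hS]
  ring

/-- Fundamental solution with pole at `(0,σ₀)`: the translate
`𝒢_{σ₀}(z,σ) = C_{α,p} ρ(z,σ−σ₀)^{−(Q−p)/(p−1)}` is a fundamental solution of `−𝓛_{α,p}`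
with pole at `(0,σ₀)`. -/
theorem fundamental_solution_translated (m k : ℕ) (hm : 1 ≤ m) (hk : 1 ≤ k)
    (α : ℝ) (hα : 0 < α) (p : ℝ) (hp : 1 < p)
    (Φ : Euc m → ℝ) (Ψ : Euc k → ℝ) (hΦ : IsMinkowskiNorm Φ) (hΨ : IsMinkowskiNorm Ψ)
    (Q : ℝ) (hQ : Q = (m : ℝ) + (α + 1) * (k : ℝ)) (hpQ : p ≠ Q) (hQp : p < Q)
    (ω σap C : ℝ)
    (hω : ω = ∫ x : Euc m × Euc k in {x | rho α Φ Ψ x < 1},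
      (dualNorm Φ x.1 / rho α Φ Ψ x) ^ (α * p))
    (hσ : σap = Q * ω)
    (hC : C = (p - 1) / (Q - p) * σap ^ (-(1 / (p - 1))))
    (σ₀ : Euc k)
    (G : Euc m × Euc k → ℝ)
    (hG : ∀ x : Euc m × Euc k, G x = C * rho α Φ Ψ (x.1, x.2 - σ₀) ^ (-((Q - p) / (p - 1))))
    (φ : Euc m × Euc k → ℝ) (hφ : ContDiff ℝ (⊤ : ℕ∞) φ) (hφc : HasCompactSupport φ) :
    ∫ x : Euc m × Euc k,
      (Φ (gradZ G x) ^ 2 + dualNorm Φ x.1 ^ (2 * α) / 4 * Ψ (gradS G x) ^ 2) ^ ((p - 2) / 2) *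
        (Φ (gradZ G x) * ⟪gradient Φ (gradZ G x), gradZ φ x⟫ +
          dualNorm Φ x.1 ^ (2 * α) / 4 * Ψ (gradS G x) *
            ⟪gradient Ψ (gradS G x), gradS φ x⟫)
      = φ (0, σ₀) := by
  have hm0 : (0 : ℝ) < m := by exact_mod_cast hm
  have hQ0 : 0 < Q := by
    rw [hQ]
    positivity
  have hp0 : 0 < p := one_pos.trans hp
  have hp1 : 0 < p - 1 := sub_pos.2 hp
  have hQp' : 0 < Q - p := sub_pos.2 hQp
  have hΦ' := hΦ.dualNorm_isGauge hm
  have hΨ' := hΨ.dualNorm_isGauge hk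
  have hμ : 0 < (homMeasure α p Q Φ Ψ).real (shell α Φ Ψ) :=
    ENNReal.toReal_pos (homMeasure_shell_ne_zero hm hα hΦ' hΨ' hQ)
      (homMeasure_shell_ne_top hm hk hα hp0 hQ0.le hΦ' hΨ')
  have hσ' : σap = (homMeasure α p Q Φ Ψ).real (shell α Φ Ψ) := by
    rw [hσ, hω, setIntegral_rho_lt_one hm hk hα hp0 hQ0 hQ hΦ' hΨ']
    field_simp
  have hσ0 : 0 < σap := hσ' ▸ hμ
  have hCγ : C * ((Q - p) / (p - 1)) = σap ^ (-(1 / (p - 1))) := by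
    rw [hC]
    field_simp
  have hK : 0 < C * ((Q - p) / (p - 1)) := hCγ ▸ rpow_pos_of_pos hσ0 _
  have hKp : (C * ((Q - p) / (p - 1))) ^ (p - 1) = σap⁻¹ := by
    rw [hCγ, ← rpow_mul hσ0.le, neg_mul, one_div_mul_cancel hp1.ne', rpow_neg_one]
  have hφ1 : ContDiff ℝ 1 φ := hφ.of_le (by exact_mod_cast le_top)
  set v : Euc m × Euc k := (0, σ₀) with hv
  have hψ1 : ContDiff ℝ 1 fun y => φ (y + v) := hφ1.comp (contDiff_id.add contDiff_const)
  have hψc : HasCompactSupport fun y => φ (y + v) :=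
    hφc.comp_homeomorph (Homeomorph.addRight v)
  have hae : ∀ᵐ x : Euc m × Euc k, x.2 - σ₀ ≠ 0 := by
    have : Nonempty (Fin k) := ⟨⟨0, hk⟩⟩
    filter_upwards [Measure.quasiMeasurePreserving_snd.ae (Measure.ae_ne volume σ₀)] with x hx
    exact sub_ne_zero.2 hx
  have hinv : (volume : Measure (Euc m × Euc k)).IsAddRightInvariant :=
    inferInstanceAs ((volume : Measure (Euc m)).prod (volume : Measure (Euc k))).IsAddRightInvariant
  calc _ = ∫ x : Euc m × Euc k, -(σap⁻¹ * (homDensity α p Q Φ Ψ (x - v) *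
        fderiv ℝ (fun y => φ (y + v)) (x - v) ((x - v).1, (α + 1) • (x - v).2))) := by
        refine integral_congr_ae ?_
        filter_upwards [ae_fst_ne_zero hm, hae] with x hx hx2
        have hxv : x - v = (x.1, x.2 - σ₀) := by simp [hv, Prod.ext_iff]
        rw [weak_integrand_eq hm hk hα hΦ hΨ hK (div_mul_cancel₀ _ hp1.ne') σ₀ hG hx hx2
          (hφ1.differentiable one_ne_zero).differentiableAt, hKp, fderiv_comp_add_right,
          sub_add_cancel, hxv]
    _ = -(σap⁻¹ * ∫ x : Euc m × Euc k, homDensity α p Q Φ Ψ x *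
        fderiv ℝ (fun y => φ (y + v)) x (x.1, (α + 1) • x.2)) := by
        rw [integral_sub_right_eq_self (fun x : Euc m × Euc k =>
          -(σap⁻¹ * (homDensity α p Q Φ Ψ x *
            fderiv ℝ (fun y => φ (y + v)) x (x.1, (α + 1) • x.2)))) v, integral_neg,
          integral_const_mul]
    _ = φ v := by
        rw [integral_homDensity_mul_fderiv hm hk hα hp0 hQ hΦ' hΨ' hψ1 hψc, ← hσ', zero_add]
        field_simp
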